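/- For every finite simple graph G and every probability distribution P on V(G), H(G,P) = log₂ χ_f(G[{v ∈ V(G) : p_v > 0}]) (where G[·] denotes the induced subgraph on the support of P) if and only if there exists a finite multiset S of independent sets of G such that (1) S is uniform over {v ∈ V(G) : p_v > 0}, and (2) every independent set I ∈ S is a maximum weighted independent set of G with respect to P. -/

import Mathlib

open Finset

/-- `I` is an independent set of the graph `G`. -/
def IsIndepSet {V : Type*} (G : SimpleGraph V) (I : Finset V) : Prop :=
  ∀ u ∈ I, ∀ w ∈ I, ¬ G.Adj u w

/-- The characteristic vector (in `ℝ^V`) of a finite set of vertices. -/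
def charVec {V : Type*} [DecidableEq V] (I : Finset V) : V → ℝ :=
  fun v => if v ∈ I then 1 else 0

/-- The vertex packing polytope `VP(G)`: the convex hull of the characteristic
vectors of the independent sets of `G`. -/
def vertexPacking {V : Type*} [Fintype V] [DecidableEq V] (G : SimpleGraph V) : Set (V → ℝ) :=
  convexHull ℝ {x | ∃ I : Finset V, IsIndepSet G I ∧ x = charVec I}

/-- `P` is a probability distribution on the (finite) vertex set `V`. -/
def IsProbDist {V : Type*} [Fintype V] (P : V → ℝ) : Prop :=
  (∀ v, 0 ≤ P v) ∧ ∑ v, P v = 1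

/-- The entropy of the graph `G` with respect to `P`:
`H(G,P) = min_{a ∈ VP(G)} ∑_v p_v · log₂(1/a_v)`, where (by the convention
`0 · log₂(1/0) = 0`) coordinates with `p_v = 0` are irrelevant and the minimum
is never achieved with `a_v = 0` at a coordinate with `p_v > 0`; accordingly the
minimization is over points of `VP(G)` that are positive on the support of `P`. -/
noncomputable def graphEntropy {V : Type*} [Fintype V] [DecidableEq V]
    (G : SimpleGraph V) (P : V → ℝ) : ℝ :=
  sInf { x | ∃ a ∈ vertexPacking G, (∀ v, 0 < P v → 0 < a v) ∧
      x = ∑ v, P v * Real.logb 2 (1 / a v) }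

/-- The fractional chromatic number of `G`: the minimum of `∑_I w_I` over
nonnegative weight functions on the independent sets of `G` such that
`∑_{I ∋ v} w_I ≥ 1` for every vertex `v`. -/
noncomputable def fracChromatic {V : Type*} [Fintype V] [DecidableEq V]
    (G : SimpleGraph V) : ℝ :=
  sInf { x | ∃ w : Finset V → ℝ, (∀ I, 0 ≤ w I) ∧ (∀ I, w I ≠ 0 → IsIndepSet G I) ∧
      (∀ v : V, 1 ≤ ∑ I ∈ Finset.univ.filter (fun I : Finset V => v ∈ I), w I) ∧
      x = ∑ I : Finset V, w I }

/-- The independence number `α(G)`. -/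
noncomputable def indepNum {V : Type*} [Fintype V] (G : SimpleGraph V) : ℕ :=
  sSup {n | ∃ I : Finset V, IsIndepSet G I ∧ I.card = n}

/-- `I` is a maximum weighted independent set of `G` with respect to `P`. -/
def IsMaxWeightIndep {V : Type*} [Fintype V] (G : SimpleGraph V) (P : V → ℝ)
    (I : Finset V) : Prop :=
  IsIndepSet G I ∧ ∀ J : Finset V, IsIndepSet G J → ∑ v ∈ J, P v ≤ ∑ v ∈ I, P v

/-- A multiset `S` of (independent) sets uniformly covers `W` if every vertex of `W`
belongs to exactly the same (positive) number of members of `S`, counted with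
multiplicity. -/
def UniformOver {V : Type*} [DecidableEq V] (S : Multiset (Finset V)) (W : Set V) : Prop :=
  ∃ c : ℕ, 0 < c ∧ ∀ v ∈ W, (S.filter (fun I => v ∈ I)).card = c

/-- `G` is symmetric with respect to graph entropy: the uniform distribution
maximizes `H(G, ·)`. -/
def EntropySymmetric {V : Type*} [Fintype V] [DecidableEq V] (G : SimpleGraph V) : Prop :=
  ∀ P : V → ℝ, IsProbDist P →
    graphEntropy G P ≤ graphEntropy G (fun _ => (1 : ℝ) / Fintype.card V)

/-- `w` is a fractional cover of the vertex set `W` by independent sets of `G`. -/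
structure IsFracCover {V : Type*} [Fintype V] [DecidableEq V] (G : SimpleGraph V) (W : Set V)
    (w : Finset V → ℝ) : Prop where
  nonneg : ∀ I, 0 ≤ w I
  indep : ∀ I, w I ≠ 0 → IsIndepSet G I
  cover : ∀ v ∈ W, 1 ≤ ∑ I with v ∈ I, w I

open Classical in
/-- The pushforward of a weight function along a map. -/
noncomputable def pushWeight {α β : Type*} [Fintype α] (f : α → β) (w : α → ℝ) (b : β) : ℝ :=
  ∑ a with f a = b, w a

lemma sum_filter_pushWeight {α β : Type*} [Fintype α] [Fintype β] (f : α → β)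
    (w : α → ℝ) (p : β → Prop) [DecidablePred p] :
    ∑ b with p b, pushWeight f w b = ∑ a with p (f a), w a := by
  classical
  simp only [pushWeight, Finset.sum_filter]
  have h : ∀ b, (if p b then ∑ a, (if f a = b then w a else 0) else 0)
      = ∑ a, if f a = b then (if p b then w a else 0) else 0 := by
    intro b
    split_ifs <;> simp
  simp only [h]
  rw [Finset.sum_comm]
  simp

lemma sum_pushWeight {α β : Type*} [Fintype α] [Fintype β] (f : α → β) (w : α → ℝ) :
    ∑ b, pushWeight f w b = ∑ a, w a := by
  simpa using sum_filter_pushWeight f w (fun _ => True)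

lemma pushWeight_nonneg {α β : Type*} [Fintype α] (f : α → β) {w : α → ℝ} (hw : ∀ a, 0 ≤ w a)
    (b : β) : 0 ≤ pushWeight f w b :=
  Finset.sum_nonneg fun a _ => hw a

lemma exists_of_pushWeight_ne_zero {α β : Type*} [Fintype α] {f : α → β} {w : α → ℝ} {b : β}
    (h : pushWeight f w b ≠ 0) : ∃ a, f a = b ∧ w a ≠ 0 := by
  classical
  obtain ⟨a, ha, hne⟩ := Finset.exists_ne_zero_of_sum_ne_zero h
  exact ⟨a, (Finset.mem_filter.mp ha).2, hne⟩

/-- The fractional chromatic number of an induced subgraph, in terms of fractional covers by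
independent sets of the ambient graph. -/
lemma fracChromatic_induce {V : Type*} [Fintype V] [DecidableEq V] (G : SimpleGraph V)
    (W : Set V) [Fintype W] [DecidableEq W] :
    fracChromatic (G.induce W) = sInf {x | ∃ w, IsFracCover G W w ∧ x = ∑ I, w I} := by
  classical
  unfold fracChromatic
  congr 1
  ext x
  constructor
  · rintro ⟨w, h0, hI, hc, rfl⟩
    let f : Finset W → Finset V := fun I => I.map (Function.Embedding.subtype (· ∈ W))
    refine ⟨pushWeight f w, ⟨pushWeight_nonneg f h0, ?_, ?_⟩, (sum_pushWeight f w).symm⟩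
    · intro J hJ
      obtain ⟨I, rfl, hne⟩ := exists_of_pushWeight_ne_zero hJ
      intro u hu v hv huv
      obtain ⟨u', hu', rfl⟩ := Finset.mem_map.mp hu
      obtain ⟨v', hv', rfl⟩ := Finset.mem_map.mp hv
      exact hI I hne u' hu' v' hv' huv
    · intro v hv
      rw [sum_filter_pushWeight f w (fun J => v ∈ J)]
      refine (hc ⟨v, hv⟩).trans_eq (Finset.sum_congr ?_ fun _ _ => rfl)
      ext I
      simp [f, hv]
  · rintro ⟨w, ⟨h0, hI, hc⟩, rfl⟩
    let f : Finset V → Finset W := fun I => I.subtype (· ∈ W)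
    refine ⟨pushWeight f w, pushWeight_nonneg f h0, ?_, ?_, (sum_pushWeight f w).symm⟩
    · intro J hJ
      obtain ⟨I, rfl, hne⟩ := exists_of_pushWeight_ne_zero hJ
      intro u hu v hv huv
      exact hI I hne u (Finset.mem_subtype.mp hu) v (Finset.mem_subtype.mp hv) huv
    · intro v
      rw [sum_filter_pushWeight f w (fun J => v ∈ J)]
      refine (hc v v.2).trans_eq (Finset.sum_congr ?_ fun _ _ => rfl)
      ext I
      simp [f]

lemma isFracCover_singletons {V : Type*} [Fintype V] [DecidableEq V] (G : SimpleGraph V)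
    (W : Set V) : IsFracCover G W (fun I => if I.card = 1 then 1 else 0) := by
  refine ⟨fun I => by split_ifs <;> simp, ?_, ?_⟩
  · intro I hI
    have h1 : I.card = 1 := by
      by_contra h
      simp [h] at hI
    obtain ⟨a, rfl⟩ := Finset.card_eq_one.mp h1
    intro u hu v hv
    rw [Finset.mem_singleton] at hu hv
    subst hu hv
    exact G.irrefl
  · intro v _
    have h := Finset.single_le_sum (s := Finset.univ.filter fun I : Finset V => v ∈ I)
      (f := fun I : Finset V => if I.card = 1 then (1 : ℝ) else 0)
      (fun I _ => by split_ifs <;> simp) (a := {v}) (by simp)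
    simpa using h

/-- A fractional cover of minimum total weight exists. -/
lemma exists_optimal_fracCover {V : Type*} [Fintype V] [DecidableEq V] (G : SimpleGraph V)
    (W : Set V) [Fintype W] [DecidableEq W] :
    ∃ w, IsFracCover G W w ∧ ∑ I, w I = fracChromatic (G.induce W) := by
  set w₀ : Finset V → ℝ := fun I => if I.card = 1 then 1 else 0
  have hw₀ : IsFracCover G W w₀ := isFracCover_singletons G W
  let K : Set (Finset V → ℝ) := {w | IsFracCover G W w ∧ ∑ I, w I ≤ ∑ I, w₀ I}
  have hK : IsCompact K := by
    refine (isCompact_Icc (a := (0 : Finset V → ℝ)) (b := fun _ => ∑ I, w₀ I)).of_isClosed_subset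
      ?_ ?_
    · have hset : K = (⋂ I, {w : Finset V → ℝ | 0 ≤ w I}) ∩
          (⋂ I, ⋂ (_ : ¬ IsIndepSet G I), {w : Finset V → ℝ | w I = 0}) ∩
          (⋂ v ∈ W, {w : Finset V → ℝ | 1 ≤ ∑ I with v ∈ I, w I}) ∩
          {w : Finset V → ℝ | ∑ I, w I ≤ ∑ I, w₀ I} := by
        ext w
        simp only [Set.mem_inter_iff, Set.mem_iInter, Set.mem_ofPred_eq, K]
        constructor
        · rintro ⟨⟨a, b, c⟩, d⟩
          exact ⟨⟨⟨a, fun I hI => by_contra fun h => hI (b I h)⟩, c⟩, d⟩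
        · rintro ⟨⟨⟨a, b⟩, c⟩, d⟩
          exact ⟨⟨a, fun I hI => by_contra fun h => hI (b I h), c⟩, d⟩
      rw [hset]
      refine ((IsClosed.inter ?_ ?_).inter ?_).inter ?_
      · exact isClosed_iInter fun I => isClosed_le (by fun_prop) (by fun_prop)
      · exact isClosed_iInter fun I => isClosed_iInter fun _ =>
          isClosed_eq (by fun_prop) (by fun_prop)
      · exact isClosed_iInter fun v => isClosed_iInter fun _ =>
          isClosed_le (by fun_prop) (by fun_prop)
      · exact isClosed_le (by fun_prop) (by fun_prop)
    · rintro w ⟨hw, hs⟩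
      exact ⟨hw.nonneg, fun I =>
        (Finset.single_le_sum (fun J _ => hw.nonneg J) (Finset.mem_univ I)).trans hs⟩
  obtain ⟨w, ⟨hw, hs⟩, hmin⟩ := hK.exists_isMinOn ⟨w₀, hw₀, le_rfl⟩
    (f := fun w => ∑ I, w I) (by fun_prop)
  refine ⟨w, hw, ?_⟩
  rw [fracChromatic_induce]
  symm
  refine IsLeast.csInf_eq ⟨⟨w, hw, rfl⟩, ?_⟩
  rintro x ⟨u, hu, rfl⟩
  rcases le_total (∑ I, u I) (∑ I, w₀ I) with h | h
  · exact isMinOn_iff.mp hmin u ⟨hu, h⟩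
  · exact hs.trans h

lemma sum_mul_weight_eq {V : Type*} [Fintype V] [DecidableEq V] (P : V → ℝ)
    (w : Finset V → ℝ) :
    ∑ I, w I * ∑ v ∈ I, P v = ∑ v, P v * ∑ I with v ∈ I, w I := by
  simp only [Finset.sum_filter, Finset.mul_sum]
  rw [Finset.sum_comm]
  refine Finset.sum_congr rfl fun I _ => ?_
  simp only [mul_ite, mul_zero, Finset.sum_ite_mem, Finset.univ_inter]
  exact Finset.sum_congr rfl fun v _ => mul_comm _ _

lemma IsFracCover.le_mul_cover {V : Type*} [Fintype V] [DecidableEq V] {G : SimpleGraph V}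
    {P : V → ℝ} (hP : ∀ v, 0 ≤ P v) {w : Finset V → ℝ} (hw : IsFracCover G {v | 0 < P v} w)
    (v : V) : P v ≤ P v * ∑ I with v ∈ I, w I := by
  rcases (hP v).eq_or_lt with h | h
  · simp [← h]
  · exact le_mul_of_one_le_right h.le (hw.cover v h)

lemma IsFracCover.one_le_sum_mul_weight {V : Type*} [Fintype V] [DecidableEq V]
    {G : SimpleGraph V} {P : V → ℝ} (hP : IsProbDist P) {w : Finset V → ℝ}
    (hw : IsFracCover G {v | 0 < P v} w) : 1 ≤ ∑ I, w I * ∑ v ∈ I, P v := by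
  rw [sum_mul_weight_eq, ← hP.2]
  exact Finset.sum_le_sum fun v _ => hw.le_mul_cover hP.1 v

lemma IsFracCover.one_le_sum {V : Type*} [Fintype V] [DecidableEq V] {G : SimpleGraph V}
    {P : V → ℝ} (hP : IsProbDist P) {w : Finset V → ℝ} (hw : IsFracCover G {v | 0 < P v} w) :
    1 ≤ ∑ I, w I := by
  refine (hw.one_le_sum_mul_weight hP).trans (Finset.sum_le_sum fun I _ => ?_)
  refine mul_le_of_le_one_right (hw.nonneg I) ?_
  rw [← hP.2]
  exact Finset.sum_le_sum_of_subset_of_nonneg (Finset.subset_univ I) fun v _ _ => hP.1 v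

/-- A fractional cover of total weight `s` yields a point of the vertex packing polytope whose
coordinates on the covered set are at least `1 / s`. -/
lemma IsFracCover.exists_mem_vertexPacking {V : Type*} [Fintype V] [DecidableEq V]
    {G : SimpleGraph V} {W : Set V} {w : Finset V → ℝ} (hw : IsFracCover G W w)
    (hs : 0 < ∑ I, w I) : ∃ b ∈ vertexPacking G, ∀ v ∈ W, (∑ I, w I)⁻¹ ≤ b v := by
  classical
  set s := ∑ I, w I with hsdef
  refine ⟨∑ I with w I ≠ 0, (s⁻¹ * w I) • charVec I, ?_, ?_⟩
  · refine (convex_convexHull ℝ _).sum_mem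
      (fun I _ => mul_nonneg (inv_nonneg.mpr hs.le) (hw.nonneg I)) ?_ ?_
    · rw [← Finset.mul_sum, Finset.sum_filter_ne_zero, ← hsdef, inv_mul_cancel₀ hs.ne']
    · intro I hI
      exact subset_convexHull ℝ _ ⟨I, hw.indep I (Finset.mem_filter.mp hI).2, rfl⟩
  · intro v hv
    have h : (∑ I with w I ≠ 0, (s⁻¹ * w I) • charVec I) v = s⁻¹ * ∑ I with v ∈ I, w I := by
      rw [Finset.sum_apply, Finset.mul_sum, Finset.sum_filter, Finset.sum_filter]
      refine Finset.sum_congr rfl fun I _ => ?_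
      by_cases h0 : w I = 0 <;> by_cases hvI : v ∈ I <;> simp [charVec, h0, hvI]
    rw [h]
    exact le_mul_of_one_le_right (inv_nonneg.mpr hs.le) (hw.cover v hv)

lemma le_one_of_mem_vertexPacking {V : Type*} [Fintype V] [DecidableEq V] {G : SimpleGraph V}
    {a : V → ℝ} (ha : a ∈ vertexPacking G) (v : V) : a v ≤ 1 := by
  have hconv : Convex ℝ {a : V → ℝ | a v ≤ 1} :=
    convex_halfSpace_le (LinearMap.proj (R := ℝ) (φ := fun _ : V => ℝ) v).isLinear 1
  refine convexHull_min ?_ hconv ha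
  rintro _ ⟨I, -, rfl⟩
  simp only [charVec, Set.mem_ofPred_eq]
  split_ifs <;> simp

lemma sum_mul_le_of_mem_vertexPacking {V : Type*} [Fintype V] [DecidableEq V]
    {G : SimpleGraph V} {P : V → ℝ} {M : ℝ} (hM : ∀ I, IsIndepSet G I → ∑ v ∈ I, P v ≤ M)
    {a : V → ℝ} (ha : a ∈ vertexPacking G) : ∑ v, P v * a v ≤ M := by
  have hlin : IsLinearMap ℝ fun a : V → ℝ => ∑ v, P v * a v :=
    ⟨fun x y => by simp [mul_add, Finset.sum_add_distrib],
      fun c x => by simp [Finset.mul_sum, mul_left_comm]⟩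
  refine convexHull_min ?_ (convex_halfSpace_le hlin M) ha
  rintro _ ⟨I, hI, rfl⟩
  simpa [charVec] using hM I hI

lemma mul_logb_inv_nonneg {V : Type*} [Fintype V] [DecidableEq V] {G : SimpleGraph V}
    {P : V → ℝ} (hP : ∀ v, 0 ≤ P v) {a : V → ℝ} (ha : a ∈ vertexPacking G)
    (hpos : ∀ v, 0 < P v → 0 < a v) (v : V) : 0 ≤ P v * Real.logb 2 (1 / a v) := by
  rcases (hP v).eq_or_lt with h | h
  · simp [← h]
  · exact mul_nonneg h.le (Real.logb_nonneg one_lt_two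
      (one_le_one_div (hpos v h) (le_one_of_mem_vertexPacking ha v)))

lemma graphEntropy_le {V : Type*} [Fintype V] [DecidableEq V] {G : SimpleGraph V}
    {P : V → ℝ} (hP : ∀ v, 0 ≤ P v) {a : V → ℝ} (ha : a ∈ vertexPacking G)
    (hpos : ∀ v, 0 < P v → 0 < a v) :
    graphEntropy G P ≤ ∑ v, P v * Real.logb 2 (1 / a v) := by
  refine csInf_le ⟨0, ?_⟩ ⟨a, ha, hpos, rfl⟩
  rintro x ⟨b, hb, hbpos, rfl⟩
  exact Finset.sum_nonneg fun v _ => mul_logb_inv_nonneg hP hb hbpos v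

lemma graphEntropy_le_of_lowerBound {V : Type*} [Fintype V] [DecidableEq V]
    {G : SimpleGraph V} {P : V → ℝ} (hP : ∀ v, 0 ≤ P v) {a c : V → ℝ}
    (ha : a ∈ vertexPacking G) (hc : ∀ v, 0 < P v → 0 < c v)
    (hca : ∀ v, 0 < P v → c v ≤ a v) :
    graphEntropy G P ≤ ∑ v, P v * Real.logb 2 (1 / c v) := by
  refine (graphEntropy_le hP ha fun v hv => (hc v hv).trans_le (hca v hv)).trans
    (Finset.sum_le_sum fun v _ => ?_)
  rcases (hP v).eq_or_lt with h | h
  · simp [← h]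
  · have h1 := hc v h
    have h2 := hca v h
    exact mul_le_mul_of_nonneg_left (Real.logb_le_logb_of_le one_lt_two
      (one_div_pos.mpr (h1.trans_le h2)) (one_div_le_one_div_of_le h1 h2)) h.le

lemma IsFracCover.graphEntropy_le {V : Type*} [Fintype V] [DecidableEq V] {G : SimpleGraph V}
    {P : V → ℝ} (hP : IsProbDist P) {w : Finset V → ℝ} (hw : IsFracCover G {v | 0 < P v} w) :
    graphEntropy G P ≤ Real.logb 2 (∑ I, w I) := by
  have hs : 0 < ∑ I, w I := one_pos.trans_le (hw.one_le_sum hP)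
  obtain ⟨b, hb, hle⟩ := hw.exists_mem_vertexPacking hs
  refine (graphEntropy_le_of_lowerBound hP.1 hb (c := fun _ => (∑ I, w I)⁻¹)
    (fun _ _ => inv_pos.mpr hs) hle).trans_eq ?_
  rw [← Finset.sum_mul, hP.2, one_mul, one_div, inv_inv]

/-- If every independent set has weight at most `M`, the entropy is at least `log₂ (1 / M)`. -/
lemma logb_inv_le_graphEntropy {V : Type*} [Fintype V] [DecidableEq V] {G : SimpleGraph V}
    {P : V → ℝ} (hP : IsProbDist P) {M : ℝ} (hM0 : 0 < M)
    (hM : ∀ I, IsIndepSet G I → ∑ v ∈ I, P v ≤ M) :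
    Real.logb 2 M⁻¹ ≤ graphEntropy G P := by
  have hw := isFracCover_singletons G {v | 0 < P v}
  have hs := one_pos.trans_le (hw.one_le_sum hP)
  obtain ⟨b, hb, hle⟩ := hw.exists_mem_vertexPacking hs
  refine le_csInf ⟨_, b, hb, fun v hv => (inv_pos.mpr hs).trans_le (hle v hv), rfl⟩ ?_
  rintro x ⟨a, ha, hpos, rfl⟩
  have hsum : ∑ v, P v * Real.log (1 / a v) ≥ Real.log M⁻¹ := by
    have hterm : ∀ v, P v * Real.log M⁻¹ + P v - P v * a v * M⁻¹
        ≤ P v * Real.log (1 / a v) := by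
      intro v
      rcases (hP.1 v).eq_or_lt with h | h
      · simp [← h]
      · have hav := hpos v h
        have hlog := Real.log_le_sub_one_of_pos (mul_pos hav (inv_pos.mpr hM0))
        rw [Real.log_mul hav.ne' (inv_pos.mpr hM0).ne'] at hlog
        rw [one_div, Real.log_inv (a v)]
        nlinarith [mul_le_mul_of_nonneg_left hlog h.le]
    have h := Finset.sum_le_sum fun v (_ : v ∈ Finset.univ) => hterm v
    rw [Finset.sum_sub_distrib, Finset.sum_add_distrib, ← Finset.sum_mul, ← Finset.sum_mul,
      hP.2] at h
    have h2 : (∑ v, P v * a v) * M⁻¹ ≤ 1 := by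
      rw [← div_eq_mul_inv]
      exact (div_le_one hM0).mpr (sum_mul_le_of_mem_vertexPacking hM ha)
    linarith
  simp only [Real.logb, ← mul_div_assoc]
  rw [← Finset.sum_div]
  exact div_le_div_of_nonneg_right hsum (Real.log_pos one_lt_two).le

/-- If a fractional cover of total weight `s` shows that the entropy equals `log₂ s`, then every
independent set has weight at most `1 / s`. -/
lemma IsFracCover.weight_le_inv {V : Type*} [Fintype V] [DecidableEq V] {G : SimpleGraph V}
    {P : V → ℝ} (hP : IsProbDist P) {w : Finset V → ℝ} (hw : IsFracCover G {v | 0 < P v} w)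
    (hent : Real.logb 2 (∑ I, w I) ≤ graphEntropy G P) {J : Finset V} (hJ : IsIndepSet G J) :
    ∑ v ∈ J, P v ≤ (∑ I, w I)⁻¹ := by
  have hs1 := hw.one_le_sum hP
  obtain ⟨b, hb, hle⟩ := hw.exists_mem_vertexPacking (one_pos.trans_le hs1)
  set s := ∑ I, w I
  set p := ∑ v ∈ J, P v
  have hs : 0 < s := one_pos.trans_le hs1
  have hp0 : 0 ≤ p := Finset.sum_nonneg fun v _ => hP.1 v
  have hp1 : p ≤ 1 := by
    rw [← hP.2]
    exact Finset.sum_le_sum_of_subset_of_nonneg (Finset.subset_univ J) fun v _ _ => hP.1 v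
  have key : ∀ t : ℝ, 0 < t → t < 1 →
      p * Real.log (1 - t + t * s) + (1 - p) * Real.log (1 - t) ≤ 0 := by
    intro t ht0 ht1
    have hx : 0 < 1 - t + t * s := by nlinarith
    have hmem : (1 - t) • b + t • charVec J ∈ vertexPacking G :=
      convex_convexHull ℝ _ hb (subset_convexHull ℝ _ ⟨J, hJ, rfl⟩) (by linarith) ht0.le (by ring)
    have h := hent.trans (graphEntropy_le_of_lowerBound hP.1 hmem
      (c := fun v => s⁻¹ * if v ∈ J then 1 - t + t * s else 1 - t) ?_ ?_)
    · have hlog : ∀ v, P v * Real.logb 2 (1 / (s⁻¹ * if v ∈ J then 1 - t + t * s else 1 - t))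
          = (P v * Real.log s - (P v * Real.log (1 - t)
            + if v ∈ J then P v * (Real.log (1 - t + t * s) - Real.log (1 - t)) else 0))
              / Real.log 2 := by
        intro v
        have hc : (if v ∈ J then 1 - t + t * s else 1 - t) ≠ 0 := by
          split_ifs
          · exact hx.ne'
          · linarith
        rw [Real.logb, one_div, Real.log_inv, Real.log_mul (inv_pos.mpr hs).ne' hc, Real.log_inv]
        split_ifs <;> ring
      simp only [hlog] at h
      rw [← Finset.sum_div, Real.logb, div_le_div_iff_of_pos_right (Real.log_pos one_lt_two),
        Finset.sum_sub_distrib, Finset.sum_add_distrib, ← Finset.sum_mul, ← Finset.sum_mul,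
        hP.2, Finset.sum_ite_mem, Finset.univ_inter, ← Finset.sum_mul] at h
      change _ ≤ _ - (_ + p * _) at h
      linarith
    · intro v _
      refine mul_pos (inv_pos.mpr hs) ?_
      split_ifs
      · exact hx
      · linarith
    · intro v hv
      have hbv := mul_le_mul_of_nonneg_left (hle v hv) (by linarith : 0 ≤ 1 - t)
      have hss : s⁻¹ * s = 1 := inv_mul_cancel₀ hs.ne'
      simp only [Pi.add_apply, Pi.smul_apply, smul_eq_mul, charVec]
      split_ifs
      · have : s⁻¹ * (1 - t + t * s) = (1 - t) * s⁻¹ + t := by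
          rw [mul_add, mul_left_comm, hss]; ring
        linarith
      · linarith
  by_contra! hlt
  have hε : 0 < p * s - 1 := by
    have := mul_lt_mul_of_pos_right hlt hs
    rw [inv_mul_cancel₀ hs.ne'] at this
    linarith
  have hεs : p * s ≤ s := mul_le_of_le_one_left hs.le hp1
  set t := (p * s - 1) / (2 * s) with ht
  have ht0 : 0 < t := by positivity
  have hts : t * (2 * s) = p * s - 1 := div_mul_cancel₀ _ (by positivity)
  have ht1 : t < 1 := by
    rw [ht, div_lt_one (by positivity)]
    linarith
  have hk := key t ht0 ht1
  have hx : 0 < 1 - t + t * s := by nlinarith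
  have hy : 0 < 1 - t := by linarith
  have h1 := Real.one_sub_inv_le_log_of_pos hx
  have h2 := Real.one_sub_inv_le_log_of_pos hy
  have h3 : p * (1 - (1 - t + t * s)⁻¹) + (1 - p) * (1 - (1 - t)⁻¹) ≤ 0 :=
    (add_le_add (mul_le_mul_of_nonneg_left h1 hp0)
      (mul_le_mul_of_nonneg_left h2 (by linarith))).trans hk
  have h4 : p * (1 - (1 - t + t * s)⁻¹) + (1 - p) * (1 - (1 - t)⁻¹)
      = t * (p * s - 1 - t * (s - 1)) / ((1 - t + t * s) * (1 - t)) := by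
    field_simp
    ring
  have h5 : 0 < t * (p * s - 1 - t * (s - 1)) / ((1 - t + t * s) * (1 - t)) := by
    refine div_pos (mul_pos ht0 ?_) (mul_pos hx hy)
    nlinarith
  linarith

/-- Moving from a nonnegative vector along a direction with a negative coordinate, supported
in the support of the vector, one reaches a nonnegative vector with a new zero coordinate. -/
lemma exists_add_mul_eq_zero {ι : Type*} [Fintype ι] {w d : ι → ℝ} (hw : ∀ i, 0 ≤ w i)
    (hd : ∀ i, w i = 0 → d i = 0) (hneg : ∃ i, d i < 0) :
    ∃ t : ℝ, (∀ i, 0 ≤ w i + t * d i) ∧ ∃ i, w i ≠ 0 ∧ w i + t * d i = 0 := by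
  classical
  obtain ⟨j, hj⟩ := hneg
  obtain ⟨i, hi, hmin⟩ := Finset.exists_min_image (Finset.univ.filter fun i => d i < 0)
    (fun i => w i / -d i) ⟨j, by simpa using hj⟩
  have hdi : d i < 0 := by simpa using hi
  refine ⟨w i / -d i, fun k => ?_, i, fun h => hdi.ne (hd i h), ?_⟩
  · rcases lt_or_ge (d k) 0 with hk | hk
    · have h := hmin k (by simpa using hk)
      rw [le_div_iff₀ (by linarith)] at h
      linarith
    · exact add_nonneg (hw k) (mul_nonneg (div_nonneg (hw i) (by linarith)) hk)
  · have := hdi.ne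
    field_simp
    ring

/-- A rational linear system with a nonnegative real solution has a nonnegative rational
solution with no larger support. -/
lemma exists_rat_solution {ι κ : Type*} [Fintype ι] (A : κ → ι → ℚ) (b : κ → ℚ)
    (w : ι → ℝ) (hw : ∀ i, 0 ≤ w i) (h : ∀ k, ∑ i, (A k i : ℝ) * w i = b k) :
    ∃ q : ι → ℚ, (∀ i, 0 ≤ q i) ∧ (∀ i, w i = 0 → q i = 0) ∧
      ∀ k, ∑ i, A k i * q i = b k := by
  classical
  obtain ⟨f, hf⟩ := LinearMap.exists_leftInverse_of_injective (Algebra.linearMap ℚ ℝ)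
    (LinearMap.ker_eq_bot.mpr (algebraMap ℚ ℝ).injective)
  have hfq : ∀ r : ℚ, f (r : ℝ) = r := fun r => LinearMap.congr_fun hf r
  induction hn : (Finset.univ.filter fun i => w i ≠ 0).card using Nat.strong_induction_on
    generalizing w with
  | _ n ih =>
  have hfw : ∀ k, ∑ i, A k i * f (w i) = b k := by
    intro k
    rw [← hfq (b k), ← h k, map_sum]
    refine Finset.sum_congr rfl fun i _ => ?_
    rw [← Rat.smul_def, map_smul, smul_eq_mul]
  by_cases heq : ∀ i, (f (w i) : ℝ) = w i
  · refine ⟨fun i => f (w i), fun i => ?_, fun i hi => by simp [hi], hfw⟩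
    have := hw i
    rw [← heq i] at this
    exact_mod_cast this
  have hfwR : ∀ k, ∑ i, (A k i : ℝ) * (f (w i) : ℝ) = b k := by
    intro k
    exact_mod_cast congrArg (fun r : ℚ => (r : ℝ)) (hfw k)
  push Not at heq
  obtain ⟨j, hj⟩ := heq
  obtain ⟨d, hd0, hdA, hneg⟩ : ∃ d : ι → ℝ, (∀ i, w i = 0 → d i = 0) ∧
      (∀ k, ∑ i, (A k i : ℝ) * d i = 0) ∧ ∃ i, d i < 0 := by
    rcases lt_or_gt_of_ne hj with hlt | hgt
    · exact ⟨fun i => f (w i) - w i, fun i hi => by simp [hi],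
        fun k => by simp only [mul_sub, Finset.sum_sub_distrib, h, hfwR, sub_self],
        j, sub_neg.mpr hlt⟩
    · exact ⟨fun i => w i - f (w i), fun i hi => by simp [hi],
        fun k => by simp only [mul_sub, Finset.sum_sub_distrib, h, hfwR, sub_self],
        j, sub_neg.mpr hgt⟩
  obtain ⟨t, hnn, i₀, hi₀, hz⟩ := exists_add_mul_eq_zero hw hd0 hneg
  have hsupp : ∀ i, w i = 0 → w i + t * d i = 0 := fun i hi => by simp [hi, hd0 i hi]
  obtain ⟨q, hq0, hqs, hqA⟩ := ih _ (by
      rw [← hn]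
      refine Finset.card_lt_card (Finset.ssubset_iff_subset_ne.mpr ⟨fun i hi => ?_, fun he => ?_⟩)
      · simp only [Finset.mem_filter, Finset.mem_univ, true_and] at hi ⊢
        exact fun h0 => hi (hsupp i h0)
      · have := he.symm ▸ Finset.mem_filter.mpr ⟨Finset.mem_univ i₀, hi₀⟩
        exact (Finset.mem_filter.mp this).2 hz)
    (fun i => w i + t * d i) hnn
    (fun k => by
      simp only [mul_add, Finset.sum_add_distrib, h, mul_left_comm _ t, ← Finset.mul_sum, hdA,
        mul_zero, add_zero])
    rfl
  exact ⟨q, hq0, fun i hi => hqs i (hsupp i hi), hqA⟩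

lemma exists_common_denominator {ι : Type*} [Fintype ι] (q : ι → ℚ) (hq : ∀ i, 0 ≤ q i) :
    ∃ N : ℕ, 0 < N ∧ ∃ m : ι → ℕ, ∀ i, (m i : ℚ) = N * q i := by
  refine ⟨∏ i, (q i).den, Finset.prod_pos fun i _ => (q i).den_pos, ?_⟩
  have h : ∀ i, ∃ m : ℕ, (m : ℚ) = (∏ i, (q i).den : ℕ) * q i := by
    intro i
    obtain ⟨c, hc⟩ := Finset.dvd_prod_of_mem (fun i => (q i).den) (Finset.mem_univ i)
    obtain ⟨n, hn⟩ := Int.eq_ofNat_of_zero_le (Rat.num_nonneg.mpr (hq i))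
    refine ⟨c * n, ?_⟩
    have hd := Rat.mul_den_eq_num (q i)
    rw [hn] at hd
    push_cast at hd
    rw [hc]
    push_cast
    rw [← hd]
    ring
  choose m hm using h
  exact ⟨m, hm⟩

/-- A real weighting of sets that covers every vertex of `W` with total weight exactly one can
be replaced by a multiset of sets of positive weight that is uniform over `W`. -/
lemma exists_uniformOver_of_exact_cover {V : Type*} [Fintype V] [DecidableEq V] {W : Set V}
    {w : Finset V → ℝ} (hw : ∀ I, 0 ≤ w I) (hc : ∀ v ∈ W, ∑ I with v ∈ I, w I = 1) :
    ∃ S : Multiset (Finset V), UniformOver S W ∧ ∀ I ∈ S, w I ≠ 0 := by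
  obtain ⟨q, hq0, hqs, hqA⟩ := exists_rat_solution
    (fun (v : W) (I : Finset V) => if v.1 ∈ I then 1 else 0) (fun _ => 1) w hw
    (fun v => by simpa [Finset.sum_filter, apply_ite (Rat.cast : ℚ → ℝ)] using hc v v.2)
  obtain ⟨N, hN, m, hm⟩ := exists_common_denominator q hq0
  refine ⟨∑ I, Multiset.replicate (m I) I, ⟨N, hN, fun v hv => ?_⟩, fun I hI h0 => ?_⟩
  · have hcard : ((∑ I, Multiset.replicate (m I) I).filter fun I => v ∈ I).card
        = ∑ I, if v ∈ I then m I else 0 := by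
      rw [← Multiset.countP_eq_card_filter, ← Multiset.coe_countPAddMonoidHom, map_sum]
      refine Finset.sum_congr rfl fun I _ => ?_
      rw [Multiset.coe_countPAddMonoidHom, Multiset.countP_eq_card_filter]
      split_ifs with h
      · rw [Multiset.filter_eq_self.mpr, Multiset.card_replicate]
        intro J hJ
        rwa [Multiset.eq_of_mem_replicate hJ]
      · rw [Multiset.filter_eq_nil.mpr, Multiset.card_zero]
        intro J hJ
        rwa [Multiset.eq_of_mem_replicate hJ]
    rw [hcard]
    have h1 := hqA ⟨v, hv⟩
    have h2 : ((∑ I, if v ∈ I then m I else 0 : ℕ) : ℚ) = N := by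
      push_cast
      rw [← mul_one (N : ℚ), ← h1, Finset.mul_sum]
      refine Finset.sum_congr rfl fun I _ => ?_
      split_ifs <;> simp [hm]
    exact_mod_cast h2
  · obtain ⟨J, -, hJ⟩ := Multiset.mem_sum.mp hI
    obtain ⟨hne, rfl⟩ := Multiset.mem_replicate.mp hJ
    apply hne
    have := hm I
    rw [hqs I h0, mul_zero] at this
    exact_mod_cast this

/-- A multiset of independent sets that is uniform over `W` yields a fractional cover of `W`
that is exact on `W` and supported on the multiset. -/
lemma UniformOver.exists_exact_fracCover {V : Type*} [Fintype V] [DecidableEq V]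
    {G : SimpleGraph V} {W : Set V} {S : Multiset (Finset V)} (hS : UniformOver S W)
    (hI : ∀ I ∈ S, IsIndepSet G I) :
    ∃ w, IsFracCover G W w ∧ (∀ v ∈ W, ∑ I with v ∈ I, w I = 1) ∧ ∀ I, w I ≠ 0 → I ∈ S := by
  obtain ⟨c, hc, hu⟩ := hS
  have hcR : (c : ℝ) ≠ 0 := by exact_mod_cast hc.ne'
  have hsupp : ∀ I, (S.count I : ℝ) / c ≠ 0 → I ∈ S := by
    intro I h
    by_contra hn
    simp [Multiset.count_eq_zero_of_notMem hn] at h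
  have hexact : ∀ v ∈ W, ∑ I with v ∈ I, (S.count I : ℝ) / c = 1 := by
    intro v hv
    have h : ∑ I with v ∈ I, S.count I = c := by
      rw [← hu v hv, ← Multiset.sum_count_eq_card (s := Finset.univ) fun _ _ => Finset.mem_univ _,
        Finset.sum_filter]
      exact Finset.sum_congr rfl fun I _ =>
        (Multiset.count_filter (p := fun I => v ∈ I) ..).symm
    rw [← Finset.sum_div, div_eq_one_iff_eq hcR]
    exact_mod_cast h
  exact ⟨fun I => S.count I / c, ⟨fun I => by positivity, fun I h => hI I (hsupp I h),
    fun v hv => (hexact v hv).ge⟩, hexact, hsupp⟩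

/-- An exact fractional cover of the support of `P` by maximum weighted independent sets
computes the entropy and the fractional chromatic number of the support. -/
lemma IsFracCover.graphEntropy_eq {V : Type*} [Fintype V] [DecidableEq V] {G : SimpleGraph V}
    {P : V → ℝ} (hP : IsProbDist P) [Fintype {v : V | 0 < P v}] [DecidableEq {v : V | 0 < P v}]
    {w : Finset V → ℝ} (hw : IsFracCover G {v | 0 < P v} w)
    (hexact : ∀ v ∈ {v | 0 < P v}, ∑ I with v ∈ I, w I = 1)
    (hmax : ∀ I, w I ≠ 0 → IsMaxWeightIndep G P I) :
    graphEntropy G P = Real.logb 2 (fracChromatic (G.induce {v : V | 0 < P v})) := by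
  have hs := one_pos.trans_le (hw.one_le_sum hP)
  obtain ⟨I₀, -, hI₀⟩ := Finset.exists_ne_zero_of_sum_ne_zero hs.ne'
  have hM := (hmax I₀ hI₀).2
  set M := ∑ v ∈ I₀, P v
  have hsM : (∑ I, w I) * M = 1 := by
    rw [Finset.sum_mul, ← hP.2]
    calc ∑ I, w I * M = ∑ I, w I * ∑ v ∈ I, P v := by
          refine Finset.sum_congr rfl fun I _ => ?_
          by_cases h0 : w I = 0
          · simp [h0]
          · exact congrArg _
              (le_antisymm ((hmax I h0).2 I₀ (hmax I₀ hI₀).1) (hM I (hmax I h0).1))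
      _ = ∑ v, P v * ∑ I with v ∈ I, w I := sum_mul_weight_eq P w
      _ = ∑ v, P v := by
          refine Finset.sum_congr rfl fun v _ => ?_
          rcases (hP.1 v).eq_or_lt with h | h
          · simp [← h]
          · rw [hexact v h, mul_one]
  have hM0 : 0 < M := pos_of_mul_pos_right (hsM ▸ one_pos) hs.le
  have hinv : M⁻¹ = ∑ I, w I := (eq_inv_of_mul_eq_one_left hsM).symm
  have hchi : fracChromatic (G.induce {v : V | 0 < P v}) = ∑ I, w I := by
    rw [fracChromatic_induce]
    refine IsLeast.csInf_eq ⟨⟨w, hw, rfl⟩, ?_⟩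
    rintro x ⟨u, hu, rfl⟩
    rw [← hinv, inv_le_iff_one_le_mul₀ hM0, Finset.sum_mul]
    refine (hu.one_le_sum_mul_weight hP).trans (Finset.sum_le_sum fun I _ => ?_)
    by_cases h0 : u I = 0
    · simp [h0]
    · exact mul_le_mul_of_nonneg_left (hM I (hu.indep I h0)) (hu.nonneg I)
  rw [hchi]
  exact le_antisymm (hw.graphEntropy_le hP) (hinv ▸ logb_inv_le_graphEntropy hP hM0 hM)

/-- If the entropy is at least the logarithm of the total weight of a fractional cover, then the
cover is exact on the support and consists of maximum weighted independent sets. -/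
lemma IsFracCover.exact_of_logb_le_graphEntropy {V : Type*} [Fintype V] [DecidableEq V]
    {G : SimpleGraph V} {P : V → ℝ} (hP : IsProbDist P) {w : Finset V → ℝ}
    (hw : IsFracCover G {v | 0 < P v} w)
    (hent : Real.logb 2 (∑ I, w I) ≤ graphEntropy G P) :
    (∀ v ∈ {v | 0 < P v}, ∑ I with v ∈ I, w I = 1) ∧
      ∀ I, w I ≠ 0 → IsMaxWeightIndep G P I := by
  have hs := one_pos.trans_le (hw.one_le_sum hP)
  have hM : ∀ J, IsIndepSet G J → ∑ v ∈ J, P v ≤ (∑ I, w I)⁻¹ :=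
    fun J hJ => hw.weight_le_inv hP hent hJ
  have hterm : ∀ I ∈ Finset.univ, w I * ∑ v ∈ I, P v ≤ w I * (∑ I, w I)⁻¹ := by
    intro I _
    by_cases h0 : w I = 0
    · simp [h0]
    · exact mul_le_mul_of_nonneg_left (hM I (hw.indep I h0)) (hw.nonneg I)
  have hone : ∑ I, w I * (∑ I, w I)⁻¹ = 1 := by
    rw [← Finset.sum_mul, mul_inv_cancel₀ hs.ne']
  have hsum : ∑ I, w I * ∑ v ∈ I, P v = 1 :=
    le_antisymm ((Finset.sum_le_sum hterm).trans_eq hone) (hw.one_le_sum_mul_weight hP)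
  constructor
  · intro v hv
    have h := (Finset.sum_eq_sum_iff_of_le fun v _ => hw.le_mul_cover hP.1 v).mp
      (by rw [← sum_mul_weight_eq, hsum, hP.2]) v (Finset.mem_univ v)
    exact (mul_eq_left₀ (ne_of_gt hv)).mp h.symm
  · intro I hI
    have h := (Finset.sum_eq_sum_iff_of_le hterm).mp (hsum.trans hone.symm) I (Finset.mem_univ I)
    exact ⟨hw.indep I hI, fun J hJ => (hM J hJ).trans_eq (mul_left_cancel₀ hI h).symm⟩

open Classical in
/-- `H(G,P) = log₂ χ_f(G[support P])` iff there is a multiset of independent sets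
that is uniform over the support of `P` and consists of maximum weighted
independent sets with respect to `P`. -/
theorem entropy_eq_logb_fracChromatic_support_iff_uniform_cover
    {V : Type*} [Fintype V] [DecidableEq V] (G : SimpleGraph V) (P : V → ℝ)
    (hP : IsProbDist P) :
    graphEntropy G P = Real.logb 2 (fracChromatic (G.induce {v : V | 0 < P v})) ↔
      ∃ S : Multiset (Finset V),
        UniformOver S {v : V | 0 < P v} ∧ ∀ I ∈ S, IsMaxWeightIndep G P I := by
  constructor
  · intro h
    obtain ⟨w, hw, hsum⟩ := exists_optimal_fracCover G {v : V | 0 < P v}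
    obtain ⟨hexact, hmax⟩ := hw.exact_of_logb_le_graphEntropy hP (by rw [hsum, h])
    obtain ⟨S, hS, hSw⟩ := exists_uniformOver_of_exact_cover hw.nonneg hexact
    exact ⟨S, hS, fun I hI => hmax I (hSw I hI)⟩
  · rintro ⟨S, hS, hmax⟩
    obtain ⟨w, hw, hexact, hsupp⟩ := hS.exists_exact_fracCover fun I hI => (hmax I hI).1
    exact hw.graphEntropy_eq hP hexact fun I hI => hmax I (hsupp I hI)
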